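/- Let G be a connected graph and let (A,B) be a split of G with frontiers A' and B'. Let G_A be the graph on A ∪ {q}, where q is a new vertex, whose edges are those of the induced subgraph G[A] together with all edges from q to A'; let G_B be the graph on B ∪ {q'}, where q' is a new vertex, whose edges are those of G[B] together with all edges from q' to B'. Then G is a circle graph if and only if both G_A and G_B are circle graphs. -/

import Mathlib

open List

variable {α : Type*}

/-- Two elements `x` and `y` alternate in the cyclic word `D`. -/
def Alternate (D : List α) (x y : α) : Prop :=
  ∃ A B C E : List α, D ~r ([x] ++ A ++ [y] ++ B ++ [x] ++ C ++ [y] ++ E)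

/-- `D` is a chord diagram on the set `W`. -/
def IsChordDiagramOn [DecidableEq α] (W : Set α) (D : List α) : Prop :=
  (∀ v ∈ W, D.count v = 2) ∧ ∀ v ∈ D, v ∈ W

/-- The cyclic word `D` represents `G` on the vertex set `W`. -/
def RepresentsOn (W : Set α) (D : List α) (G : SimpleGraph α) : Prop :=
  ∀ x ∈ W, ∀ y ∈ W, x ≠ y → (G.Adj x y ↔ Alternate D x y)

/-- `G` is a circle graph on the vertex set `W`. -/
def IsCircleGraphOn [DecidableEq α] (W : Set α) (G : SimpleGraph α) : Prop :=
  ∃ D : List α, IsChordDiagramOn W D ∧ RepresentsOn W D G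

/-- `(A, B)` is a split of the graph `G` on vertex set `W`, with frontiers `A'`
and `B'`. -/
def IsSplitOn (W : Set α) (G : SimpleGraph α) (A B A' B' : Set α) : Prop :=
  A ∪ B = W ∧ Disjoint A B ∧ 2 ≤ A.ncard ∧ 2 ≤ B.ncard ∧
    A' ⊆ A ∧ B' ⊆ B ∧ ∀ a ∈ A, ∀ b ∈ B, (G.Adj a b ↔ a ∈ A' ∧ b ∈ B')

theorem filter_isRotated_filter {D D' : List α} (p : α → Bool) (h : D ~r D') :
    D.filter p ~r D'.filter p := by
  obtain ⟨n, rfl⟩ := h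
  rw [rotate_eq_drop_append_take_mod, filter_append]
  nth_rewrite 1 [← take_append_drop (n % D.length) D]
  rw [filter_append]
  exact isRotated_append

/-- Two elements occurring twice alternate iff deleting all other letters leaves an alternating
word. -/
theorem alternate_iff_filter_eq [DecidableEq α] {D : List α} {x y : α} (hxy : x ≠ y)
    (hx : D.count x = 2) (hy : D.count y = 2) :
    Alternate D x y ↔ D.filter (fun z => z = x ∨ z = y) = [x, y, x, y] ∨
      D.filter (fun z => z = x ∨ z = y) = [y, x, y, x] := by
  constructor
  · rintro ⟨A, B, C, E, h⟩
    have hcx := h.perm.count_eq x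
    have hcy := h.perm.count_eq y
    simp only [count_append, count_singleton_self, count_singleton, beq_iff_eq, hxy, hxy.symm,
      if_false, hx, hy] at hcx hcy
    have key : ∀ L : List α, L.count x = 0 → L.count y = 0 →
        L.filter (fun z => z = x ∨ z = y) = [] := by
      intro L h1 h2
      rw [count_eq_zero] at h1 h2
      simp only [filter_eq_nil_iff, decide_eq_true_eq]
      rintro z hz (rfl | rfl) <;> contradiction
    have hf := filter_isRotated_filter (fun z => decide (z = x ∨ z = y)) h
    simp only [filter_append, key A (by lia) (by lia), key B (by lia) (by lia),
      key C (by lia) (by lia), key E (by lia) (by lia)] at hf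
    simp only [append_nil, true_or, or_true, decide_true, filter_cons_of_pos, filter_nil,
      cons_append, nil_append] at hf
    obtain ⟨n, hn, hf⟩ := isRotated_iff_mod.1 hf.symm
    simp only [length_cons, length_nil] at hn
    rw [← hf]
    interval_cases n <;> simp
  · have split : ∀ {u v : α} {p : α → Bool}, D.filter p = [u, v, u, v] →
        ∃ l₁ l₂ l₃ l₄ l₅, D = l₁ ++ u :: (l₂ ++ v :: (l₃ ++ u :: (l₄ ++ v :: l₅))) := by
      intro u v p h
      obtain ⟨l₁, r₁, rfl, -, -, h⟩ := filter_eq_cons_iff.1 h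
      obtain ⟨l₂, r₂, rfl, -, -, h⟩ := filter_eq_cons_iff.1 h
      obtain ⟨l₃, r₃, rfl, -, -, h⟩ := filter_eq_cons_iff.1 h
      obtain ⟨l₄, r₄, rfl, -, -, h⟩ := filter_eq_cons_iff.1 h
      exact ⟨l₁, l₂, l₃, l₄, r₄, rfl⟩
    rintro (h | h)
    · obtain ⟨l₁, l₂, l₃, l₄, l₅, rfl⟩ := split h
      refine ⟨l₂, l₃, l₄, l₅ ++ l₁, ?_⟩
      simpa using isRotated_append (l := l₁)
        (l' := x :: (l₂ ++ y :: (l₃ ++ x :: (l₄ ++ y :: l₅))))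
    · obtain ⟨l₁, l₂, l₃, l₄, l₅, rfl⟩ := split h
      refine ⟨l₅ ++ l₁, l₂, l₃, l₄, ?_⟩
      simpa using isRotated_append (l := l₁ ++ y :: (l₂ ++ x :: (l₃ ++ y :: l₄)))
        (l' := x :: l₅)

theorem Alternate.of_isRotated {D D' : List α} {x y : α} (h : Alternate D x y) (hr : D ~r D') :
    Alternate D' x y := by
  obtain ⟨A, B, C, E, h⟩ := h
  exact ⟨A, B, C, E, hr.symm.trans h⟩

theorem Alternate.symm {D : List α} {x y : α} (h : Alternate D x y) : Alternate D y x := by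
  obtain ⟨A, B, C, E, h⟩ := h
  refine ⟨B, C, E, A, h.trans ?_⟩
  simpa using isRotated_append (l := x :: A) (l' := y :: (B ++ x :: (C ++ y :: E)))

theorem Alternate.map {β : Type*} {D : List α} {x y : α} (f : α → β) (h : Alternate D x y) :
    Alternate (D.map f) (f x) (f y) := by
  obtain ⟨A, B, C, E, h⟩ := h
  exact ⟨A.map f, B.map f, C.map f, E.map f, by simpa using h.map f⟩

theorem alternate_map_equiv_iff {β : Type*} {D : List α} {x y : α} (e : α ≃ β) :
    Alternate (D.map e) (e x) (e y) ↔ Alternate D x y :=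
  ⟨fun h => by simpa using h.map e.symm, fun h => h.map e⟩

/-- Alternation of two elements depends only on the words they induce. -/
theorem alternate_congr_filter [DecidableEq α] {D D' : List α} {x y : α} (hxy : x ≠ y)
    (hx : D.count x = 2) (hy : D.count y = 2)
    (h : D.filter (fun z => z = x ∨ z = y) = D'.filter (fun z => z = x ∨ z = y)) :
    Alternate D x y ↔ Alternate D' x y := by
  have count_eq : ∀ u, u = x ∨ u = y → D'.count u = D.count u := by
    intro u hu
    have := congrArg (count u) h
    rwa [count_filter (by simpa using hu), count_filter (by simpa using hu), eq_comm] at this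
  rw [alternate_iff_filter_eq hxy hx hy, h, alternate_iff_filter_eq hxy
    ((count_eq x (.inl rfl)).trans hx) ((count_eq y (.inr rfl)).trans hy)]

theorem IsCircleGraphOn.mono [DecidableEq α] {W W' : Set α} {G : SimpleGraph α}
    (h : IsCircleGraphOn W G) (hW : W' ⊆ W) : IsCircleGraphOn W' G := by
  classical
  obtain ⟨D, ⟨hD, -⟩, hG⟩ := h
  have hcount : ∀ v ∈ W', (D.filter (· ∈ W')).count v = 2 := fun v hv => by
    rw [count_filter (by simpa using hv), hD v (hW hv)]
  refine ⟨D.filter (· ∈ W'), ⟨hcount, fun v hv => by simpa using (mem_filter.1 hv).2⟩, ?_⟩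
  intro x hx y hy hxy
  rw [hG x (hW hx) y (hW hy) hxy]
  refine (alternate_congr_filter hxy (hcount x hx) (hcount y hy) ?_).symm
  rw [filter_filter]
  refine filter_congr fun z _ => ?_
  by_cases hz : z = x ∨ z = y
  · have : z ∈ W' := by rcases hz with rfl | rfl <;> assumption
    simp [this]
  · simp [hz]

theorem IsCircleGraphOn.image_equiv [DecidableEq α] {W : Set α} {G H : SimpleGraph α}
    (h : IsCircleGraphOn W G) (e : α ≃ α)
    (he : ∀ x ∈ W, ∀ y ∈ W, x ≠ y → (H.Adj (e x) (e y) ↔ G.Adj x y)) :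
    IsCircleGraphOn (e '' W) H := by
  obtain ⟨D, ⟨hD, hDW⟩, hG⟩ := h
  refine ⟨D.map e, ⟨?_, ?_⟩, ?_⟩
  · rintro _ ⟨v, hv, rfl⟩
    rw [count_map_of_injective _ _ e.injective, hD v hv]
  · intro v hv
    obtain ⟨u, hu, rfl⟩ := mem_map.1 hv
    exact ⟨u, hDW u hu, rfl⟩
  · rintro _ ⟨x, hx, rfl⟩ _ ⟨y, hy, rfl⟩ hxy
    have hxy' : x ≠ y := fun h => hxy (congrArg e h)
    rw [he x hx y hy hxy', hG x hx y hy hxy', alternate_map_equiv_iff]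

/-- A part of a split is isomorphic to the subgraph induced by one side and a frontier vertex of
the other side. -/
theorem IsCircleGraphOn.part [DecidableEq α] {W A A' : Set α} {G H : SimpleGraph α} {b q : α}
    (h : IsCircleGraphOn W G) (hAW : A ⊆ W) (hbW : b ∈ W) (hbA : b ∉ A) (hqA : q ∉ A)
    (hA' : A' ⊆ A) (hb : ∀ a ∈ A, G.Adj a b ↔ a ∈ A')
    (hH : ∀ x y, H.Adj x y ↔
      (G.Adj x y ∧ x ∈ A ∧ y ∈ A) ∨ (x = q ∧ y ∈ A') ∨ (y = q ∧ x ∈ A')) :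
    IsCircleGraphOn (A ∪ {q}) H := by
  have hfix : ∀ a ∈ A, Equiv.swap b q a = a := fun a ha =>
    Equiv.swap_apply_of_ne_of_ne (ne_of_mem_of_not_mem ha hbA) (ne_of_mem_of_not_mem ha hqA)
  have himage : Equiv.swap b q '' (A ∪ {b}) = A ∪ {q} := by
    rw [Set.image_union, Set.image_singleton, Equiv.swap_apply_left,
      Set.image_congr hfix, Set.image_id']
  rw [← himage]
  refine (h.mono (W' := A ∪ {b}) (by grind)).image_equiv _ ?_
  have hqA' : q ∉ A' := fun h => hqA (hA' h)
  rintro x (hx | hx) y (hy | hy) hxy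
  · have := ne_of_mem_of_not_mem hx hqA
    have := ne_of_mem_of_not_mem hy hqA
    simp_all
  · have := ne_of_mem_of_not_mem hx hqA
    obtain rfl : y = b := hy
    rw [hfix x hx, Equiv.swap_apply_left, hH, hb x hx]
    simp_all
  · have := ne_of_mem_of_not_mem hy hqA
    obtain rfl : x = b := hx
    rw [hfix y hy, Equiv.swap_apply_left, hH, G.adj_comm x y, hb y hy]
    simp_all
  · exact absurd (hx.trans hy.symm) hxy

/-- A chord diagram may be rotated so that it starts with a prescribed chord. -/
theorem IsCircleGraphOn.exists_cons_append_cons [DecidableEq α] {W : Set α} {G : SimpleGraph α}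
    (h : IsCircleGraphOn W G) {q : α} (hq : q ∈ W) :
    ∃ X Y : List α, IsChordDiagramOn W (q :: (X ++ q :: Y)) ∧
      RepresentsOn W (q :: (X ++ q :: Y)) G := by
  obtain ⟨D, ⟨hD, hDW⟩, hG⟩ := h
  obtain ⟨L, R, rfl⟩ := append_of_mem (count_pos_iff.1 (by rw [hD q hq]; norm_num : 0 < D.count q))
  have hr : L ++ q :: R ~r q :: (R ++ L) := by
    simpa using isRotated_append (l := L) (l' := q :: R)
  have hcount := hr.perm.count_eq q
  rw [hD q hq, count_cons_self] at hcount
  obtain ⟨X, Y, hXY⟩ := append_of_mem (count_pos_iff.1 (by lia : 0 < (R ++ L).count q))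
  rw [hXY] at hr
  refine ⟨X, Y, ⟨fun v hv => ?_, fun v hv => hDW v (hr.perm.mem_iff.2 hv)⟩, ?_⟩
  · rw [← hr.perm.count_eq, hD v hv]
  · intro x hx y hy hxy
    rw [hG x hx y hy hxy]
    exact ⟨fun h => h.of_isRotated hr, fun h => h.of_isRotated hr.symm⟩

theorem filter_or_eq_replicate [DecidableEq α] {L : List α} {x y : α} (hy : y ∉ L) :
    L.filter (fun z => z = x ∨ z = y) = replicate (L.count x) x := by
  rw [← filter_eq]
  refine filter_congr fun z hz => ?_
  have : z ≠ y := ne_of_mem_of_not_mem hz hy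
  simp [this, eq_comm]

theorem filter_or_eq_replicate' [DecidableEq α] {L : List α} {x y : α} (hx : x ∉ L) :
    L.filter (fun z => z = x ∨ z = y) = replicate (L.count y) y := by
  simpa only [or_comm] using filter_or_eq_replicate (x := y) hx

/-- The chords alternating with `q` are those with one end on either side of `q`. -/
theorem alternate_cons_append_cons_iff [DecidableEq α] {X Y : List α} {q a : α} (hqa : q ≠ a)
    (hqX : q ∉ X) (hqY : q ∉ Y) (ha : X.count a + Y.count a = 2) :
    Alternate (q :: (X ++ q :: Y)) q a ↔ X.count a = 1 := by
  rw [alternate_iff_filter_eq hqa (by simp [count_eq_zero.2 hqX, count_eq_zero.2 hqY])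
    (by simp [hqa, ha])]
  simp only [filter_cons, filter_append, true_or, decide_true, if_true,
    filter_or_eq_replicate' hqX, filter_or_eq_replicate' hqY]
  obtain ⟨i, hi⟩ : ∃ i, X.count a = i := ⟨_, rfl⟩
  have hY : Y.count a = 2 - i := by lia
  have : i ≤ 2 := by lia
  rw [hi, hY]
  interval_cases i <;> simp [replicate_succ, hqa, hqa.symm]

theorem alternate_interleave_iff [DecidableEq α] {X Y X' Y' : List α} {a b : α} (hab : a ≠ b)
    (hbX : b ∉ X) (hbY : b ∉ Y) (haX' : a ∉ X') (haY' : a ∉ Y')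
    (ha : X.count a + Y.count a = 2) (hb : X'.count b + Y'.count b = 2) :
    Alternate (X ++ X' ++ Y ++ Y') a b ↔ X.count a = 1 ∧ X'.count b = 1 := by
  rw [alternate_iff_filter_eq hab
    (by simp [count_append, count_eq_zero.2 haX', count_eq_zero.2 haY', ha])
    (by simp [count_append, count_eq_zero.2 hbX, count_eq_zero.2 hbY, hb])]
  simp only [filter_append, filter_or_eq_replicate hbX, filter_or_eq_replicate hbY,
    filter_or_eq_replicate' haX', filter_or_eq_replicate' haY']
  obtain ⟨i, hi⟩ : ∃ i, X.count a = i := ⟨_, rfl⟩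
  obtain ⟨j, hj⟩ : ∃ j, X'.count b = j := ⟨_, rfl⟩
  have hY : Y.count a = 2 - i := by lia
  have hY' : Y'.count b = 2 - j := by lia
  have : i ≤ 2 := by lia
  have : j ≤ 2 := by lia
  rw [hi, hY, hj, hY']
  interval_cases i <;> interval_cases j <;> simp [replicate_succ, hab, hab.symm]

/-- The two arcs cut out by the chord `q` of a chord diagram of a part of a split, with what they
record about the graph. -/
theorem IsCircleGraphOn.exists_arcs [DecidableEq α] {A A' : Set α} {G H : SimpleGraph α} {q : α}
    (h : IsCircleGraphOn (A ∪ {q}) H) (hqA : q ∉ A) (hA' : A' ⊆ A)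
    (hH : ∀ x y, H.Adj x y ↔
      (G.Adj x y ∧ x ∈ A ∧ y ∈ A) ∨ (x = q ∧ y ∈ A') ∨ (y = q ∧ x ∈ A')) :
    ∃ X Y : List α, (∀ v ∈ X, v ∈ A) ∧ (∀ v ∈ Y, v ∈ A) ∧
      (∀ a ∈ A, X.count a + Y.count a = 2) ∧ (∀ a ∈ A, X.count a = 1 ↔ a ∈ A') ∧
      RepresentsOn A (X ++ Y) G := by
  obtain ⟨X, Y, ⟨hD, hDW⟩, hR⟩ := h.exists_cons_append_cons (q := q) (by simp)
  have hq := hD q (by simp)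
  simp only [count_cons_self, count_append] at hq
  have hqX : q ∉ X := count_eq_zero.1 (by lia)
  have hqY : q ∉ Y := count_eq_zero.1 (by lia)
  have hne : ∀ a ∈ A, q ≠ a := fun a ha => (ne_of_mem_of_not_mem ha hqA).symm
  have hcount : ∀ a ∈ A, X.count a + Y.count a = 2 := by
    intro a ha
    simpa [hne a ha] using hD a (.inl ha)
  have hqA' : q ∉ A' := fun h => hqA (hA' h)
  refine ⟨X, Y, fun v hv => ?_, fun v hv => ?_, hcount, fun a ha => ?_, ?_⟩
  · exact (hDW v (by simp [hv])).resolve_right (ne_of_mem_of_not_mem hv hqX)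
  · exact (hDW v (by simp [hv])).resolve_right (ne_of_mem_of_not_mem hv hqY)
  · rw [← alternate_cons_append_cons_iff (hne a ha) hqX hqY (hcount a ha),
      ← hR q (by simp) a (.inl ha) (hne a ha), hH]
    simp [hqA, hqA']
  · intro x hx y hy hxy
    have hxq := hne x hx
    have hyq := hne y hy
    have hadj : H.Adj x y ↔ G.Adj x y := by rw [hH]; simp [hx, hy, hxq.symm, hyq.symm]
    rw [← hadj, hR x (.inl hx) y (.inl hy) hxy]
    refine alternate_congr_filter hxy (hD x (.inl hx)) (hD y (.inl hy)) ?_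
    simp [hxq, hyq]

/-- Chord diagrams of the parts of a split can be glued along the marker chords. -/
theorem isCircleGraphOn_union_of_parts [DecidableEq α] {A B A' B' : Set α}
    {G GA GB : SimpleGraph α} {q q' : α} (hAB : Disjoint A B) (hA' : A' ⊆ A) (hB' : B' ⊆ B)
    (hadj : ∀ a ∈ A, ∀ b ∈ B, (G.Adj a b ↔ a ∈ A' ∧ b ∈ B')) (hqA : q ∉ A) (hqB : q' ∉ B)
    (hGA : ∀ x y, GA.Adj x y ↔
      (G.Adj x y ∧ x ∈ A ∧ y ∈ A) ∨ (x = q ∧ y ∈ A') ∨ (y = q ∧ x ∈ A'))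
    (hGB : ∀ x y, GB.Adj x y ↔
      (G.Adj x y ∧ x ∈ B ∧ y ∈ B) ∨ (x = q' ∧ y ∈ B') ∨ (y = q' ∧ x ∈ B'))
    (hA : IsCircleGraphOn (A ∪ {q}) GA) (hB : IsCircleGraphOn (B ∪ {q'}) GB) :
    IsCircleGraphOn (A ∪ B) G := by
  obtain ⟨X, Y, hX, hY, hcount, hfront, hR⟩ := hA.exists_arcs hqA hA' hGA
  obtain ⟨X', Y', hX', hY', hcount', hfront', hR'⟩ := hB.exists_arcs hqB hB' hGB
  have hXb : ∀ b ∈ B, b ∉ X := fun b hb h => Set.disjoint_left.1 hAB (hX b h) hb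
  have hYb : ∀ b ∈ B, b ∉ Y := fun b hb h => Set.disjoint_left.1 hAB (hY b h) hb
  have hXa : ∀ a ∈ A, a ∉ X' := fun a ha h => Set.disjoint_left.1 hAB ha (hX' a h)
  have hYa : ∀ a ∈ A, a ∉ Y' := fun a ha h => Set.disjoint_left.1 hAB ha (hY' a h)
  have hD : ∀ v ∈ A ∪ B, (X ++ X' ++ Y ++ Y').count v = 2 := by
    rintro v (hv | hv)
    · simp [count_append, count_eq_zero.2 (hXa v hv), count_eq_zero.2 (hYa v hv), hcount v hv]
    · simp [count_append, count_eq_zero.2 (hXb v hv), count_eq_zero.2 (hYb v hv), hcount' v hv]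
  have hnil : ∀ {L : List α} {x y : α}, x ∉ L → y ∉ L →
      L.filter (fun z => z = x ∨ z = y) = [] := by
    intro L x y hx hy
    rw [filter_or_eq_replicate hy, count_eq_zero.2 hx, replicate_zero]
  have hcross : ∀ a ∈ A, ∀ b ∈ B, (G.Adj a b ↔ Alternate (X ++ X' ++ Y ++ Y') a b) := by
    intro a ha b hb
    rw [alternate_interleave_iff (hAB.ne_of_mem ha hb) (hXb b hb) (hYb b hb) (hXa a ha)
      (hYa a ha) (hcount a ha) (hcount' b hb), hfront a ha, hfront' b hb, hadj a ha b hb]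
  refine ⟨X ++ X' ++ Y ++ Y', ⟨hD, fun v hv => ?_⟩, ?_⟩
  · simp only [mem_append] at hv
    rcases hv with ((hv | hv) | hv) | hv
    exacts [.inl (hX v hv), .inr (hX' v hv), .inl (hY v hv), .inr (hY' v hv)]
  · rintro x (hx | hx) y (hy | hy) hxy
    · rw [hR x hx y hy hxy]
      refine (alternate_congr_filter hxy (hD x (.inl hx)) (hD y (.inl hy)) ?_).symm
      simp only [filter_append, hnil (hXa x hx) (hXa y hy), hnil (hYa x hx) (hYa y hy),
        append_nil]
    · exact hcross x hx y hy
    · rw [G.adj_comm, hcross y hy x hx]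
      exact ⟨Alternate.symm, Alternate.symm⟩
    · rw [hR' x hx y hy hxy]
      refine (alternate_congr_filter hxy (hD x (.inr hx)) (hD y (.inr hy)) ?_).symm
      simp only [filter_append, hnil (hXb x hx) (hXb y hy), hnil (hYb x hx) (hYb y hy),
        append_nil, nil_append]

theorem IsSplitOn.exists_mem_frontiers {W A B A' B' : Set α} {G : SimpleGraph α}
    (h : IsSplitOn W G A B A' B') (hconn : (G.induce W).Connected) :
    ∃ a ∈ A', ∃ b ∈ B', a ∈ W ∧ b ∈ W := by
  obtain ⟨hW, hAB, hA, hB, -, -, hadj⟩ := h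
  obtain ⟨a, ha⟩ := Set.nonempty_of_ncard_ne_zero (by lia : A.ncard ≠ 0)
  obtain ⟨b, hb⟩ := Set.nonempty_of_ncard_ne_zero (by lia : B.ncard ≠ 0)
  have haW : a ∈ W := hW ▸ .inl ha
  have hbW : b ∈ W := hW ▸ .inr hb
  obtain ⟨p⟩ := hconn.preconnected ⟨a, haW⟩ ⟨b, hbW⟩
  obtain ⟨d, -, h₁, h₂⟩ := p.exists_boundary_dart {v | v.1 ∈ A} ha
    (fun h => Set.disjoint_left.1 hAB h hb)
  have h₃ : d.snd.1 ∈ B := (hW.symm ▸ d.snd.2 : d.snd.1 ∈ A ∪ B).resolve_left h₂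
  obtain ⟨h₄, h₅⟩ := (hadj _ h₁ _ h₃).1 d.adj
  exact ⟨_, h₄, _, h₅, d.fst.2, d.snd.2⟩

/-- Let `(A, B)` be a split of a connected graph `G` with frontiers `A'` and `B'`,
let `G_A` be `G[A]` together with a new vertex `q` joined to `A'`, and let `G_B`
be `G[B]` together with a new vertex `q'` joined to `B'`.  Then `G` is a circle
graph iff both `G_A` and `G_B` are circle graphs. -/
theorem circle_iff_split_parts_circle [DecidableEq α]
    (Vs : Set α) (G : SimpleGraph α)
    (hsupp : ∀ a b, G.Adj a b → a ∈ Vs ∧ b ∈ Vs)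
    (hconn : (G.induce Vs).Connected)
    (A B A' B' : Set α) (hsplit : IsSplitOn Vs G A B A' B')
    (q q' : α) (hq : q ∉ Vs) (hq' : q' ∉ Vs)
    (GA GB : SimpleGraph α)
    (hGA : ∀ a b, GA.Adj a b ↔
      (G.Adj a b ∧ a ∈ A ∧ b ∈ A) ∨ (a = q ∧ b ∈ A') ∨ (b = q ∧ a ∈ A'))
    (hGB : ∀ a b, GB.Adj a b ↔
      (G.Adj a b ∧ a ∈ B ∧ b ∈ B) ∨ (a = q' ∧ b ∈ B') ∨ (b = q' ∧ a ∈ B')) :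
    IsCircleGraphOn Vs G ↔
      (IsCircleGraphOn (A ∪ {q}) GA ∧ IsCircleGraphOn (B ∪ {q'}) GB) := by
  obtain ⟨a, ha, b, hb, haV, hbV⟩ := hsplit.exists_mem_frontiers hconn
  obtain ⟨rfl, hAB, -, -, hA', hB', hadj⟩ := hsplit
  have hqA : q ∉ A := fun h => hq (.inl h)
  have hqB : q' ∉ B := fun h => hq' (.inr h)
  refine ⟨fun h => ⟨?_, ?_⟩, fun h =>
    isCircleGraphOn_union_of_parts hAB hA' hB' hadj hqA hqB hGA hGB h.1 h.2⟩
  · refine h.part Set.subset_union_left hbV (Set.disjoint_right.1 hAB (hB' hb)) hqA hA' ?_ hGA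
    intro x hx
    simp [hadj x hx b (hB' hb), hb]
  · refine h.part Set.subset_union_right haV (Set.disjoint_left.1 hAB (hA' ha)) hqB hB' ?_ hGB
    intro x hx
    simp [G.adj_comm x a, hadj a (hA' ha) x hx, ha]
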